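/- For every γ in ℝ^{I×J×T}, the Lagrangian dual function decomposes: L(γ) = min_{φ in Φ̃} Σ_{(i,j) in [I]×[J]} L^φ_{i,j}(γ) = Σ_{(i,j) in [I]×[J]} min_{φ in Φ̃} L^φ_{i,j}(γ); that is, the minimum over joint randomized Markov policies of the sum of the per-component expected Lagrangian costs equals the sum over components of the per-component minima. -/

import Mathlib

noncomputable section
open scoped Classical BigOperators
open Filter

/-- The data of a MAB-ML problem (multi-action bandits with multiple linear constraints). -/
structure MABML where
  I : ℕ
  J : ℕ
  T : ℕ
  hI : 0 < I
  hJ : 0 < J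
  hT : 0 < T
  /-- size of the state space of the component `(i,j)` (nonempty finite state spaces). -/
  nS : Fin I → Fin J → ℕ
  hnS : ∀ i j, 0 < nS i j
  /-- the nonempty set `B_{i,j} ⊆ [I]` of available actions. -/
  B : Fin I → Fin J → Finset (Fin I)
  hB : ∀ i j, (B i j).Nonempty
  /-- the set `B̄_{i,j} ⊆ [I]`. -/
  Bbar : Fin I → Fin J → Finset (Fin I)
  /-- weights: `w x y j` is `w_{x,y,j}`, the coefficient of the action variable `a_{x,y,j}`. -/
  w : Fin I → Fin I → Fin J → ℝ
  hw : ∀ x y j, 0 ≤ w x y j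
  /-- the function `g_{i,j} : S_{i,j} → [0,∞)`. -/
  g : ∀ i j, Fin (nS i j) → ℝ
  hg : ∀ i j s, 0 ≤ g i j s
  /-- cost rates `c_{i,j}(s,e,t)` for binary `e`; time `t` is 0-based (`t ∈ {0,…,T-1}`). -/
  c : ∀ i j, Fin (nS i j) → Bool → ℕ → ℝ
  hc : ∀ i j s e t, 0 ≤ c i j s e t
  /-- transition kernels `P_{i,j,t}(s,e,s')` for binary `e`; time 0-based. -/
  P : ∀ i j, Fin (nS i j) → Bool → ℕ → Fin (nS i j) → ℝ
  hP : ∀ i j s e t s', 0 ≤ P i j s e t s'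
  hPsum : ∀ i j s e t, ∑ s', P i j s e t s' = 1
  /-- the initial distribution `π⁰_{i,j}`. -/
  pi0 : ∀ i j, Fin (nS i j) → ℝ
  hpi0 : ∀ i j s, 0 ≤ pi0 i j s
  hpi0sum : ∀ i j, ∑ s, pi0 i j s = 1

namespace MABML

variable (Q : MABML)

/-- The state space `S_{i,j}`. -/
abbrev State (i : Fin Q.I) (j : Fin Q.J) : Type := Fin (Q.nS i j)

/-- The joint state space `S = Π_{(i,j)} S_{i,j}`. -/
abbrev JState : Type := ∀ (i : Fin Q.I) (j : Fin Q.J), Q.State i j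

/-- Cost rates extended affinely to `e ∈ [0,1]`. -/
def cE (i : Fin Q.I) (j : Fin Q.J) (s : Q.State i j) (e : ℝ) (t : ℕ) : ℝ :=
  e * Q.c i j s true t + (1 - e) * Q.c i j s false t

/-- Transition kernels extended affinely to `e ∈ [0,1]`. -/
def PE (i : Fin Q.I) (j : Fin Q.J) (s : Q.State i j) (e : ℝ) (t : ℕ) (s' : Q.State i j) : ℝ :=
  e * Q.P i j s true t s' + (1 - e) * Q.P i j s false t s'

/-- `B̄⁻¹_{i,j} = {i' : i ∈ B̄_{i',j}}`. -/
def Binv (i : Fin Q.I) (j : Fin Q.J) : Finset (Fin Q.I) :=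
  Finset.univ.filter fun i' => i ∈ Q.Bbar i' j

/-- The action space `A_{i,j}` (as a predicate on `[0,1]^I`). -/
def memA (i : Fin Q.I) (j : Fin Q.J) (a : Fin Q.I → ℝ) : Prop :=
  (∀ i', 0 ≤ a i' ∧ a i' ≤ 1) ∧ (∑ i' ∈ Q.B i j, a i') ≤ 1 ∧ ∀ i' ∉ Q.B i j, a i' = 0

/-- `e(a) = 1 − ∏_{i' ∈ B_{i,j}} (1 − a_{i'})`. -/
def eAct (i : Fin Q.I) (j : Fin Q.J) (a : Fin Q.I → ℝ) : ℝ :=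
  1 - ∏ i' ∈ Q.B i j, (1 - a i')

/-- A randomized Markov policy: to every joint state, component `(i,j)` and (0-based) time,
an action row in `[0,1]^I`. -/
def Policy : Type := Q.JState → (i : Fin Q.I) → (j : Fin Q.J) → ℕ → (Fin Q.I → ℝ)

/-- Membership in `Φ̃`: all action rows belong to `A_{i,j}`. -/
def ValidPolicy (φ : Q.Policy) : Prop := ∀ s i j t, Q.memA i j (φ s i j t)

/-- The law of the joint process at (0-based) time `t` under policy `φ`:
the components start independently from `π⁰` and transition independently given the joint state. -/
def jointDist (φ : Q.Policy) : ℕ → Q.JState → ℝ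
  | 0, s => ∏ i, ∏ j, Q.pi0 i j (s i j)
  | t + 1, s' => ∑ s : Q.JState, jointDist φ t s *
      ∏ i, ∏ j, Q.PE i j (s i j) (Q.eAct i j (φ s i j t)) t (s' i j)

/-- The space `ℝ^{I×J×T}` of Lagrange multipliers. -/
abbrev Gamma : Type := Fin Q.I → Fin Q.J → Fin Q.T → ℝ

/-- The Lagrangian cost `C^γ_{i,j}(s,a,t)`. -/
def Cg (γ : Q.Gamma) (i : Fin Q.I) (j : Fin Q.J) (x : Q.State i j) (a : Fin Q.I → ℝ)
    (t : Fin Q.T) : ℝ :=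
  Q.cE i j x (Q.eAct i j a) t.val + γ i j t * Q.g i j x -
    ∑ i' ∈ Q.Binv i j, γ i' j t * Q.w i i' j * a i'

/-- The expected Lagrangian cost `L^φ_{i,j}(γ)`. -/
def Lsub (φ : Q.Policy) (i : Fin Q.I) (j : Fin Q.J) (γ : Q.Gamma) : ℝ :=
  ∑ t : Fin Q.T, ∑ s : Q.JState, Q.jointDist φ t.val s * Q.Cg γ i j (s i j) (φ s i j t.val) t

/-- The dual function `L(γ) = min_{φ ∈ Φ̃} Σ_{(i,j)} L^φ_{i,j}(γ)`. -/
def dual (γ : Q.Gamma) : ℝ :=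
  ⨅ φ : {φ : Q.Policy // Q.ValidPolicy φ}, ∑ i, ∑ j, Q.Lsub φ.1 i j γ

/-- Value function with `r` remaining steps (i.e. at 0-based time `T − r`);
`Vrem 0 = 0` is the terminal value. -/
def Vrem (γ : Q.Gamma) (i : Fin Q.I) (j : Fin Q.J) : ℕ → Q.State i j → ℝ
  | 0, _ => 0
  | r + 1, x =>
    ⨅ a : {a : Fin Q.I → ℝ // Q.memA i j a},
      Q.Cg γ i j x a.1 ⟨Q.T - (r + 1), Nat.sub_lt Q.hT (Nat.succ_pos r)⟩ +
        ∑ x' : Q.State i j, Q.PE i j x (Q.eAct i j a.1) (Q.T - (r + 1)) x' * Vrem γ i j r x'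

/-- The value function `V^γ_{i,j}(x,τ)` at 0-based time `τ ∈ {0,…,T}` (`τ = T` is terminal). -/
def Vt (γ : Q.Gamma) (i : Fin Q.I) (j : Fin Q.J) (τ : ℕ) (x : Q.State i j) : ℝ :=
  Q.Vrem γ i j (Q.T - τ) x

/-- `θ_{i,i',j,t}(γ)`. -/
def theta (i i' : Fin Q.I) (j : Fin Q.J) (x : ℝ) : ℝ :=
  if i' ∈ Q.B i j ∩ Q.Binv i j then x * Q.w i i' j else 0

/-- The marginal cost `ϑ^γ_{i,j}(s,t)`. -/
def vartheta (γ : Q.Gamma) (i : Fin Q.I) (j : Fin Q.J) (x : Q.State i j) (t : Fin Q.T) : ℝ :=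
  Q.c i j x true t.val - Q.c i j x false t.val +
    ∑ x' : Q.State i j,
      (Q.P i j x true t.val x' - Q.P i j x false t.val x') * Q.Vt γ i j (t.val + 1) x'

/-- `argmax_{i'' ∈ B_{i,j}} θ_{i,i'',j,t}(γ_{i'',j,t})` as a finset. -/
def amax (γ : Q.Gamma) (i : Fin Q.I) (j : Fin Q.J) (t : Fin Q.T) : Finset (Fin Q.I) :=
  (Q.B i j).filter fun i' =>
    ∀ i'' ∈ Q.B i j, Q.theta i i'' j (γ i'' j t) ≤ Q.theta i i' j (γ i' j t)

/-- `P(S^φ_{i,j}(t) = x)`. -/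
def margin (φ : Q.Policy) (i : Fin Q.I) (j : Fin Q.J) (t : ℕ) (x : Q.State i j) : ℝ :=
  ∑ s : Q.JState, if s i j = x then Q.jointDist φ t s else 0

/-- `E[a^φ_{i,i',j}(S^φ(t),t) ⋅ 1{S^φ_{i,j}(t) = x}]`, the (unnormalized) numerator of
`α^φ_{i,i',j}(x,t)`. -/
def numer (φ : Q.Policy) (i i' : Fin Q.I) (j : Fin Q.J) (t : ℕ) (x : Q.State i j) : ℝ :=
  ∑ s : Q.JState, if s i j = x then Q.jointDist φ t s * φ s i j t i' else 0

/-- The threshold conditions at `γ` for the component `(i,j)`: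
`α^φ_{i,i',j}(x,t) = 1` (i.e. `numer = margin`) whenever `θ > ϑ` and `i'` is the least element
of the argmax of `θ` over `B_{i,j}`; `α` unconstrained when `θ = ϑ` and `i'` is in the argmax;
and `α^φ_{i,i',j}(x,t) = 0` (i.e. `numer = 0`) otherwise. -/
def ThresholdAt (φ : Q.Policy) (γ : Q.Gamma) (i : Fin Q.I) (j : Fin Q.J) : Prop :=
  ∀ (t : Fin Q.T), ∀ i' ∈ Q.B i j, ∀ x : Q.State i j,
    ((Q.vartheta γ i j x t < Q.theta i i' j (γ i' j t) ∧ i' ∈ Q.amax γ i j t ∧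
        ∀ i'' ∈ Q.amax γ i j t, i' ≤ i'') →
      Q.numer φ i i' j t.val x = Q.margin φ i j t.val x) ∧
    ((¬(Q.vartheta γ i j x t < Q.theta i i' j (γ i' j t) ∧ i' ∈ Q.amax γ i j t ∧
          ∀ i'' ∈ Q.amax γ i j t, i' ≤ i'') ∧
        ¬(Q.theta i i' j (γ i' j t) = Q.vartheta γ i j x t ∧ i' ∈ Q.amax γ i j t)) →
      Q.numer φ i i' j t.val x = 0)

/-- The threshold conditions at `γ` for all components. -/
def ThresholdAll (φ : Q.Policy) (γ : Q.Gamma) : Prop := ∀ i j, Q.ThresholdAt φ γ i j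

/-- `E[α^φ_{i',i,j}(S^φ_{i',j}(t),t)] = E[a^φ_{i',i,j}(S^φ(t),t)]`. -/
def expA (φ : Q.Policy) (i' i : Fin Q.I) (j : Fin Q.J) (t : Fin Q.T) : ℝ :=
  ∑ s : Q.JState, Q.jointDist φ t.val s * φ s i' j t.val i

/-- `E[g_{i,j}(S^φ_{i,j}(t))]`. -/
def expG (φ : Q.Policy) (i : Fin Q.I) (j : Fin Q.J) (t : Fin Q.T) : ℝ :=
  ∑ s : Q.JState, Q.jointDist φ t.val s * Q.g i j (s i j)

end MABML

/-- Expectation of a function of one coordinate under a product of probability mass functions. -/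
theorem sum_prod_mul_eval {ι : Type*} [Fintype ι] [DecidableEq ι] {α : ι → Type*}
    [∀ k, Fintype (α k)] (p : ∀ k, α k → ℝ) (hp : ∀ k, ∑ x, p k x = 1) (k₀ : ι)
    (f : α k₀ → ℝ) :
    ∑ s : ∀ k, α k, (∏ k, p k (s k)) * f (s k₀) = ∑ x, p k₀ x * f x := by
  have h := (Fintype.prod_sum (Function.update p k₀ fun x => p k₀ x * f x)).symm
  have hfac : ∀ s : ∀ k, α k,
      ∏ k, Function.update p k₀ (fun x => p k₀ x * f x) k (s k) =
        (∏ k, p k (s k)) * f (s k₀) := by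
    intro s
    rw [← Finset.mul_prod_erase _ _ (Finset.mem_univ k₀),
      ← Finset.mul_prod_erase _ (fun k => p k (s k)) (Finset.mem_univ k₀),
      Finset.prod_congr rfl fun k hk => by
        rw [Function.update_of_ne (Finset.ne_of_mem_erase hk)]]
    rw [Function.update_self]
    ring
  rw [Finset.sum_congr rfl fun s _ => hfac s] at h
  rw [h, ← Finset.mul_prod_erase _ _ (Finset.mem_univ k₀),
    Finset.prod_eq_one fun k hk => by
      rw [Function.update_of_ne (Finset.ne_of_mem_erase hk), hp]]
  simp

/-- A product of probability mass functions is a probability mass function. -/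
theorem sum_prod_eq_one {ι : Type*} [Fintype ι] [DecidableEq ι] {α : ι → Type*}
    [∀ k, Fintype (α k)] (p : ∀ k, α k → ℝ) (hp : ∀ k, ∑ x, p k x = 1) :
    ∑ s : ∀ k, α k, ∏ k, p k (s k) = 1 := by
  rw [← Fintype.prod_sum]
  exact Finset.prod_eq_one fun k _ => hp k

namespace MABML

variable (Q : MABML)

theorem memA_zero (i : Fin Q.I) (j : Fin Q.J) : Q.memA i j 0 := by
  simp [memA]

theorem isCompact_setOf_memA (i : Fin Q.I) (j : Fin Q.J) : IsCompact {a | Q.memA i j a} := by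
  have hK : IsCompact (Set.Icc (0 : Fin Q.I → ℝ) 1) := isCompact_Icc
  refine hK.of_isClosed_subset ?_ fun a ha => ⟨fun k => (ha.1 k).1, fun k => (ha.1 k).2⟩
  simp only [memA, Set.ofPred_and, Set.ofPred_forall]
  refine (isClosed_iInter fun k => ?_).inter (IsClosed.inter ?_ ?_)
  · exact (isClosed_le (by fun_prop) (by fun_prop)).inter
      (isClosed_le (by fun_prop) (by fun_prop))
  · exact isClosed_le (by fun_prop) (by fun_prop)
  · exact isClosed_iInter fun k => isClosed_iInter fun _ =>
      isClosed_eq (by fun_prop) (by fun_prop)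

variable {Q}

theorem eAct_mem_Icc {i : Fin Q.I} {j : Fin Q.J} {a : Fin Q.I → ℝ} (ha : Q.memA i j a) :
    Q.eAct i j a ∈ Set.Icc (0 : ℝ) 1 := by
  have h0 : 0 ≤ ∏ i' ∈ Q.B i j, (1 - a i') :=
    Finset.prod_nonneg fun k _ => sub_nonneg.2 (ha.1 k).2
  have h1 : ∏ i' ∈ Q.B i j, (1 - a i') ≤ 1 :=
    Finset.prod_le_one (fun k _ => sub_nonneg.2 (ha.1 k).2)
      fun k _ => sub_le_self _ (ha.1 k).1
  exact ⟨sub_nonneg.2 h1, sub_le_self _ h0⟩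

theorem PE_nonneg {i : Fin Q.I} {j : Fin Q.J} {e : ℝ} (he : e ∈ Set.Icc (0 : ℝ) 1)
    (x : Q.State i j) (t : ℕ) (x' : Q.State i j) : 0 ≤ Q.PE i j x e t x' :=
  add_nonneg (mul_nonneg he.1 (Q.hP ..)) (mul_nonneg (sub_nonneg.2 he.2) (Q.hP ..))

theorem sum_PE {i : Fin Q.I} {j : Fin Q.J} (x : Q.State i j) (e : ℝ) (t : ℕ) :
    ∑ x', Q.PE i j x e t x' = 1 := by
  simp only [PE, Finset.sum_add_distrib, ← Finset.mul_sum, Q.hPsum]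
  ring

theorem jointDist_nonneg {φ : Q.Policy} (hφ : Q.ValidPolicy φ) (t : ℕ) (s : Q.JState) :
    0 ≤ Q.jointDist φ t s := by
  induction t generalizing s with
  | zero => exact Finset.prod_nonneg fun i _ => Finset.prod_nonneg fun j _ => Q.hpi0 ..
  | succ t ih =>
    exact Finset.sum_nonneg fun s' _ => mul_nonneg (ih s') <|
      Finset.prod_nonneg fun i _ => Finset.prod_nonneg fun j _ =>
        PE_nonneg (eAct_mem_Icc (hφ ..)) ..

/-- The one-step evolution of the expectation of a function of a single component. -/
theorem sum_jointDist_succ_mul (φ : Q.Policy) (t : ℕ) (i : Fin Q.I) (j : Fin Q.J)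
    (f : Q.State i j → ℝ) :
    ∑ s, Q.jointDist φ (t + 1) s * f (s i j) =
      ∑ s, Q.jointDist φ t s *
        ∑ x', Q.PE i j (s i j) (Q.eAct i j (φ s i j t)) t x' * f x' := by
  simp only [jointDist, Finset.sum_mul]
  rw [Finset.sum_comm]
  refine Finset.sum_congr rfl fun s _ => ?_
  simp only [mul_assoc]
  rw [← Finset.mul_sum]
  congr 1
  rw [sum_prod_mul_eval
      (fun i' (u : ∀ j', Q.State i' j') =>
        ∏ j', Q.PE i' j' (s i' j') (Q.eAct i' j' (φ s i' j' t)) t (u j'))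
      (fun i' => sum_prod_eq_one
        (fun j' => Q.PE i' j' (s i' j') (Q.eAct i' j' (φ s i' j' t)) t) fun _ => sum_PE ..)
      i fun u => f (u j)]
  exact sum_prod_mul_eval
    (fun j' => Q.PE i j' (s i j') (Q.eAct i j' (φ s i j' t)) t) (fun _ => sum_PE ..) j f

/-- The cost-to-go of an action at time `t`, followed by optimal behaviour. -/
def actionValue (γ : Q.Gamma) (i : Fin Q.I) (j : Fin Q.J) (t : Fin Q.T) (x : Q.State i j)
    (a : Fin Q.I → ℝ) : ℝ :=
  Q.Cg γ i j x a t + ∑ x', Q.PE i j x (Q.eAct i j a) t.val x' * Q.Vt γ i j (t.val + 1) x'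

theorem continuous_actionValue (γ : Q.Gamma) (i : Fin Q.I) (j : Fin Q.J) (t : Fin Q.T)
    (x : Q.State i j) : Continuous (actionValue γ i j t x) := by
  unfold actionValue Cg cE PE eAct
  fun_prop

theorem Vt_eq_iInf (γ : Q.Gamma) (i : Fin Q.I) (j : Fin Q.J) (t : Fin Q.T) (x : Q.State i j) :
    Q.Vt γ i j t.val x = ⨅ a : {a // Q.memA i j a}, actionValue γ i j t x a.1 := by
  have hr : Q.T - t.val = (Q.T - (t.val + 1)) + 1 := by have := t.2; omega
  have ht : Q.T - (Q.T - (t.val + 1) + 1) = t.val := by have := t.2; omega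
  rw [Vt, hr, Vrem]
  simp only [ht, actionValue, Vt]

/-- The Bellman minimum is attained. -/
theorem exists_isMinOn_actionValue (γ : Q.Gamma) (i : Fin Q.I) (j : Fin Q.J) (t : Fin Q.T)
    (x : Q.State i j) :
    ∃ a, Q.memA i j a ∧ ∀ b, Q.memA i j b → actionValue γ i j t x a ≤ actionValue γ i j t x b := by
  obtain ⟨a, ha, hmin⟩ := (Q.isCompact_setOf_memA i j).exists_isMinOn ⟨0, Q.memA_zero i j⟩
    (continuous_actionValue γ i j t x).continuousOn
  exact ⟨a, ha, fun b hb => hmin hb⟩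

theorem Vt_eq_of_forall_le {γ : Q.Gamma} {i : Fin Q.I} {j : Fin Q.J} {t : Fin Q.T}
    {x : Q.State i j} {a : Fin Q.I → ℝ} (ha : Q.memA i j a)
    (hmin : ∀ b, Q.memA i j b → actionValue γ i j t x a ≤ actionValue γ i j t x b) :
    Q.Vt γ i j t.val x = actionValue γ i j t x a := by
  rw [Vt_eq_iInf]
  have : Nonempty {a // Q.memA i j a} := ⟨⟨a, ha⟩⟩
  exact le_antisymm (ciInf_le ⟨_, by rintro _ ⟨b, rfl⟩; exact hmin b.1 b.2⟩ (⟨a, ha⟩ : {a // _}))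
    (le_ciInf fun b => hmin b.1 b.2)

theorem Vt_le_actionValue {γ : Q.Gamma} {i : Fin Q.I} {j : Fin Q.J} {t : Fin Q.T}
    {x : Q.State i j} {b : Fin Q.I → ℝ} (hb : Q.memA i j b) :
    Q.Vt γ i j t.val x ≤ actionValue γ i j t x b := by
  obtain ⟨a, ha, hmin⟩ := exists_isMinOn_actionValue γ i j t x
  exact (Vt_eq_of_forall_le ha hmin).trans_le (hmin b hb)

/-- The expected Lagrangian cost exceeds the initial value by the accumulated Bellman gaps. -/
theorem Lsub_eq_add_sum_gap (φ : Q.Policy) (γ : Q.Gamma) (i : Fin Q.I) (j : Fin Q.J) :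
    Q.Lsub φ i j γ = ∑ s : Q.JState, (∏ i', ∏ j', Q.pi0 i' j' (s i' j')) * Q.Vt γ i j 0 (s i j) +
      ∑ t : Fin Q.T, ∑ s : Q.JState, Q.jointDist φ t.val s *
        (actionValue γ i j t (s i j) (φ s i j t.val) - Q.Vt γ i j t.val (s i j)) := by
  let U : ℕ → ℝ := fun t => ∑ s : Q.JState, Q.jointDist φ t s * Q.Vt γ i j t (s i j)
  have hstep : ∀ t : Fin Q.T, ∑ s : Q.JState, Q.jointDist φ t.val s *
        (actionValue γ i j t (s i j) (φ s i j t.val) - Q.Vt γ i j t.val (s i j)) =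
      ∑ s, Q.jointDist φ t.val s * Q.Cg γ i j (s i j) (φ s i j t.val) t -
        (U t.val - U (t.val + 1)) := by
    intro t
    simp only [U, sum_jointDist_succ_mul, actionValue, mul_sub, mul_add,
      Finset.sum_sub_distrib, Finset.sum_add_distrib]
    ring
  have htel : ∑ t : Fin Q.T, (U t.val - U (t.val + 1)) = U 0 := by
    rw [Fin.sum_univ_eq_sum_range (fun t => U t - U (t + 1)), Finset.sum_range_sub']
    simp [U, Vt, Vrem]
  rw [Finset.sum_congr rfl fun t _ => hstep t, Finset.sum_sub_distrib, htel]
  simp [U, Lsub, jointDist]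

/-- Some valid policy minimizes the expected Lagrangian costs of all components at once. -/
theorem exists_valid_forall_Lsub_le (γ : Q.Gamma) :
    ∃ φ : {φ : Q.Policy // Q.ValidPolicy φ}, ∀ (ψ : {φ : Q.Policy // Q.ValidPolicy φ}) i j,
      Q.Lsub φ.1 i j γ ≤ Q.Lsub ψ.1 i j γ := by
  choose act hact hmin using
    fun i j t (x : Q.State i j) => exists_isMinOn_actionValue γ i j t x
  let φ : Q.Policy := fun s i j t => if h : t < Q.T then act i j ⟨t, h⟩ (s i j) else 0
  have hφ : Q.ValidPolicy φ := by
    intro s i j t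
    by_cases h : t < Q.T
    · simpa only [φ, h, dite_true] using hact i j ⟨t, h⟩ (s i j)
    · simpa only [φ, h, dite_false] using Q.memA_zero i j
  refine ⟨⟨φ, hφ⟩, fun ψ i j => ?_⟩
  rw [Lsub_eq_add_sum_gap, Lsub_eq_add_sum_gap]
  refine add_le_add_right (Finset.sum_le_sum fun t _ => ?_) _
  have hzero : ∀ s : Q.JState,
      actionValue γ i j t (s i j) (φ s i j t.val) - Q.Vt γ i j t.val (s i j) = 0 := by
    intro s
    simp only [φ, t.2, dite_true, Fin.eta]
    rw [Vt_eq_of_forall_le (hact i j t (s i j)) (hmin i j t (s i j)), sub_self]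
  simp only [hzero, mul_zero, Finset.sum_const_zero]
  exact Finset.sum_nonneg fun s _ =>
    mul_nonneg (jointDist_nonneg ψ.2 ..) (sub_nonneg.2 (Vt_le_actionValue (ψ.2 ..)))

end MABML

/-- Proposition 1, decomposition of the relaxed MAB-ML.
For every `γ ∈ ℝ^{I×J×T}`,
`L(γ) = min_{φ ∈ Φ̃} Σ_{(i,j)} L^φ_{i,j}(γ) = Σ_{(i,j)} min_{φ ∈ Φ̃} L^φ_{i,j}(γ)`. -/
theorem MABML.dual_decomposition (Q : MABML) (γ : Q.Gamma) :
    Q.dual γ = ∑ i : Fin Q.I, ∑ j : Fin Q.J,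
      ⨅ φ : {φ : Q.Policy // Q.ValidPolicy φ}, Q.Lsub φ.1 i j γ := by
  obtain ⟨φ, hφ⟩ := exists_valid_forall_Lsub_le γ
  have hmin {f : {φ : Q.Policy // Q.ValidPolicy φ} → ℝ} (h : ∀ ψ, f φ ≤ f ψ) :
      ⨅ ψ, f ψ = f φ :=
    have : Nonempty {φ : Q.Policy // Q.ValidPolicy φ} := ⟨φ⟩
    le_antisymm (ciInf_le ⟨f φ, by rintro _ ⟨ψ, rfl⟩; exact h ψ⟩ φ) (le_ciInf h)
  rw [dual, hmin fun ψ => Finset.sum_le_sum fun i _ => Finset.sum_le_sum fun j _ => hφ ψ i j]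
  exact Finset.sum_congr rfl fun i _ => Finset.sum_congr rfl fun j _ =>
    (hmin (f := fun ψ => Q.Lsub ψ.1 i j γ) fun ψ => hφ ψ i j).symm
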